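/- Let H be an m×n real matrix with full column rank and let k be a row index. Then the submatrix of H obtained by deleting row k fails to have full column rank (i.e., k is a critical measurement) if and only if there exists c ∈ ℝⁿ such that the support of H·c is exactly the singleton {k}. (Algebraic form of Corollary 1: a measurement is critical if and only if its critical set is the singleton containing it) -/

import Mathlib

/-- The submatrix of `H` obtained by deleting the rows indexed by `S`. -/
def delRows {m n : ℕ} (H : Matrix (Fin m) (Fin n) ℝ) (S : Set (Fin m)) :
    Matrix {i : Fin m // i ∉ S} (Fin n) ℝ :=
  Matrix.of fun i j => H i.1 j

/-- A matrix has full column rank if and only if its kernel is trivial. -/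
theorem rank_eq_card_iff_forall_mulVec_eq_zero {K ι κ : Type*} [Field K] [Fintype κ]
    (A : Matrix ι κ K) : A.rank = Fintype.card κ ↔ ∀ c, A.mulVec c = 0 → c = 0 := by
  have hrn := A.mulVecLin.finrank_range_add_finrank_ker
  rw [Module.finrank_fintype_fun_eq_card] at hrn
  have hker : A.rank = Fintype.card κ ↔ Module.finrank K (LinearMap.ker A.mulVecLin) = 0 := by
    rw [Matrix.rank]
    omega
  rw [hker, Submodule.finrank_eq_zero, LinearMap.ker_eq_bot']
  rfl

theorem delRows_mulVec_eq_zero_iff {m n : ℕ} (H : Matrix (Fin m) (Fin n) ℝ)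
    (S : Set (Fin m)) (c : Fin n → ℝ) :
    (delRows H S).mulVec c = 0 ↔ Function.support (H.mulVec c) ⊆ S := by
  rw [Function.support_subset_iff', funext_iff, Subtype.forall]
  rfl

/-- Algebraic form of Corollary 1: for `H` of full column rank, measurement `k` is
critical (deleting row `k` destroys full column rank) if and only if there is a stealthy
data injection attack `H·c` whose support is exactly the singleton `{k}`. -/
theorem critical_measurement_iff_singleton_support
    {m n : ℕ} (H : Matrix (Fin m) (Fin n) ℝ) (hH : H.rank = n) (k : Fin m) :
    ¬ (delRows H {k}).rank = n ↔
      ∃ c : Fin n → ℝ, Function.support (H.mulVec c) = {k} := by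
  have full {ι : Type} (A : Matrix ι (Fin n) ℝ) :
      A.rank = n ↔ ∀ c, A.mulVec c = 0 → c = 0 := by
    simpa using rank_eq_card_iff_forall_mulVec_eq_zero A
  rw [full] at hH ⊢
  push Not
  refine exists_congr fun c => ?_
  rw [delRows_mulVec_eq_zero_iff, Set.subset_singleton_iff_eq]
  constructor
  · rintro ⟨h | h, hc⟩
    · exact absurd (hH c (Function.support_eq_empty_iff.mp h)) hc
    · exact h
  · refine fun h => ⟨Or.inr h, ?_⟩
    rintro rfl
    simp at h
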